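/- Let α be a long root of Φ satisfying α = β + γ for some positive roots β, γ ∈ Φ^+. If α ∉ C_0 and both β and γ lie in C_0 ∪ Φ_short^+ (i.e., each of β, γ is either a short positive root or a long positive root belonging to C_0), then both β and γ are short. -/

import Mathlib

noncomputable section

namespace Paper

/-- The root lattice of rank `l`, with coordinates taken in the basis of simple roots. -/
abbrev RL (l : ℕ) := Fin l → ℤ

/-- The `i`-th simple root `αᵢ`. -/
def sroot (l : ℕ) (i : Fin l) : RL l := Pi.single i 1

/-- The Cartan pairing `⟨v, αᵢ^∨⟩` attached to a Cartan matrix `A`,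
with the convention `A i j = ⟨αⱼ, αᵢ^∨⟩`. -/
def cmPair (l : ℕ) (A : Matrix (Fin l) (Fin l) ℤ) (v : RL l) (i : Fin l) : ℤ :=
  ∑ j, A i j * v j

/-- The closure of a set `S0` of root-lattice vectors under all simple reflections
(computed with respect to the Cartan matrix `A`). -/
def orbitOf (l : ℕ) (A : Matrix (Fin l) (Fin l) ℤ) (S0 : Set (RL l)) : Set (RL l) :=
  ⋂₀ {T | S0 ⊆ T ∧ ∀ v ∈ T, ∀ i : Fin l, v - cmPair l A v i • sroot l i ∈ T}

/-- The set `Φ` of roots of the root system with Cartan matrix `A`: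
the orbit of the simple roots under the Weyl group. -/
def rootsOf (l : ℕ) (A : Matrix (Fin l) (Fin l) ℤ) : Set (RL l) :=
  orbitOf l A {v | ∃ i, v = sroot l i}

/-- The set `Φ⁺` of positive roots. -/
def posRoots (l : ℕ) (A : Matrix (Fin l) (Fin l) ℤ) : Set (RL l) :=
  {v ∈ rootsOf l A | ∀ i, 0 ≤ v i}

/-- The (suitably scaled) squared length `⟨v, v⟩` with respect to the symmetrizer `d`
(`d i` represents half the squared length of `αᵢ`). -/
def nsq (l : ℕ) (A : Matrix (Fin l) (Fin l) ℤ) (d : Fin l → ℤ) (v : RL l) : ℤ :=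
  ∑ i, ∑ j, d i * A i j * v i * v j

/-- The set of roots of squared length `c`. -/
def lenSet (l : ℕ) (A : Matrix (Fin l) (Fin l) ℤ) (d : Fin l → ℤ) (c : ℤ) : Set (RL l) :=
  {v ∈ rootsOf l A | nsq l A d v = c}

/-- The set of positive roots of squared length `c`. -/
def posLen (l : ℕ) (A : Matrix (Fin l) (Fin l) ℤ) (d : Fin l → ℤ) (c : ℤ) : Set (RL l) :=
  {v ∈ lenSet l A d c | ∀ i, 0 ≤ v i}

/-! Cartan matrices (Bourbaki numbering, shifted to be 0-indexed);
the convention is `A i j = ⟨αⱼ, αᵢ^∨⟩`. -/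

/-- The Cartan matrix of type `A_l`. -/
def CM_A (l : ℕ) : Matrix (Fin l) (Fin l) ℤ := Matrix.of fun i j =>
  if i = j then 2 else if (i : ℕ) + 1 = (j : ℕ) ∨ (j : ℕ) + 1 = (i : ℕ) then -1 else 0

/-- The Cartan matrix of type `B_l` (the last simple root is short). -/
def CM_B (l : ℕ) : Matrix (Fin l) (Fin l) ℤ := Matrix.of fun i j =>
  if i = j then 2
  else if (i : ℕ) = (j : ℕ) + 1 then (if (i : ℕ) = l - 1 then -2 else -1)
  else if (j : ℕ) = (i : ℕ) + 1 then -1 else 0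

/-- The Cartan matrix of type `C_l` (the last simple root is long). -/
def CM_C (l : ℕ) : Matrix (Fin l) (Fin l) ℤ := Matrix.of fun i j =>
  if i = j then 2
  else if (j : ℕ) = (i : ℕ) + 1 then (if (j : ℕ) = l - 1 then -2 else -1)
  else if (i : ℕ) = (j : ℕ) + 1 then -1 else 0

/-- The Cartan matrix of type `D_l`. -/
def CM_D (l : ℕ) : Matrix (Fin l) (Fin l) ℤ := Matrix.of fun i j =>
  if i = j then 2
  else if ((i : ℕ) + 1 = (j : ℕ) ∧ (j : ℕ) + 1 ≤ l - 1) ∨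
          ((j : ℕ) + 1 = (i : ℕ) ∧ (i : ℕ) + 1 ≤ l - 1) ∨
          ((i : ℕ) = l - 3 ∧ (j : ℕ) = l - 1) ∨ ((j : ℕ) = l - 3 ∧ (i : ℕ) = l - 1) then -1
  else 0

/-- The Cartan matrix of type `E_l` (`l ∈ {6,7,8}`). -/
def CM_E (l : ℕ) : Matrix (Fin l) (Fin l) ℤ := Matrix.of fun i j =>
  if i = j then 2
  else if ((i : ℕ) = 0 ∧ (j : ℕ) = 2) ∨ ((j : ℕ) = 0 ∧ (i : ℕ) = 2) ∨
          ((i : ℕ) = 1 ∧ (j : ℕ) = 3) ∨ ((j : ℕ) = 1 ∧ (i : ℕ) = 3) ∨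
          (2 ≤ (i : ℕ) ∧ (j : ℕ) = (i : ℕ) + 1) ∨
          (2 ≤ (j : ℕ) ∧ (i : ℕ) = (j : ℕ) + 1) then -1
  else 0

/-- The Cartan matrix of type `F₄` (used with `l = 4`; `α₁, α₂` long, `α₃, α₄` short). -/
def CM_F4 (l : ℕ) : Matrix (Fin l) (Fin l) ℤ := Matrix.of fun i j =>
  if i = j then 2
  else if ((i : ℕ) = 0 ∧ (j : ℕ) = 1) ∨ ((j : ℕ) = 0 ∧ (i : ℕ) = 1) ∨
          ((i : ℕ) = 1 ∧ (j : ℕ) = 2) ∨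
          ((i : ℕ) = 2 ∧ (j : ℕ) = 3) ∨ ((j : ℕ) = 2 ∧ (i : ℕ) = 3) then -1
  else if (i : ℕ) = 2 ∧ (j : ℕ) = 1 then -2 else 0

/-- The Cartan matrix of type `G₂` (used with `l = 2`; `α₁` short, `α₂` long). -/
def CM_G2 (l : ℕ) : Matrix (Fin l) (Fin l) ℤ := Matrix.of fun i j =>
  if i = j then 2
  else if (i : ℕ) = 0 ∧ (j : ℕ) = 1 then -3
  else if (i : ℕ) = 1 ∧ (j : ℕ) = 0 then -1 else 0

/-! Symmetrizers: `d i` is half the squared length of `αᵢ`, scaled so that short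
roots have squared length `2` and long roots have squared length `4` (resp. `6` in
type `G₂`). -/

/-- Symmetrizer for type `B_l`. -/
def dB (l : ℕ) : Fin l → ℤ := fun i => if (i : ℕ) = l - 1 then 1 else 2
/-- Symmetrizer for type `C_l`. -/
def dC (l : ℕ) : Fin l → ℤ := fun i => if (i : ℕ) = l - 1 then 2 else 1
/-- Symmetrizer for type `F₄`. -/
def dF4 (l : ℕ) : Fin l → ℤ := fun i => if (i : ℕ) ≤ 1 then 2 else 1
/-- Symmetrizer for type `G₂`. -/
def dG2 (l : ℕ) : Fin l → ℤ := fun i => if (i : ℕ) = 0 then 1 else 3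

/-- Adjacency in (the underlying undirected graph of) the Hasse diagram of a set `P`
of positive roots: two vertices of `P` are joined iff they differ by a simple root. -/
def hstep (l : ℕ) (P : Set (RL l)) (v w : RL l) : Prop :=
  v ∈ P ∧ w ∈ P ∧ ∃ i : Fin l, w = v + sroot l i ∨ v = w + sroot l i

/-- Connectivity (reachability) in the Hasse diagram of `P`. -/
def hconn (l : ℕ) (P : Set (RL l)) : RL l → RL l → Prop :=
  Relation.ReflTransGen (hstep l P)

/-- The connected component `𝒞₀` of the Hasse diagram `H(Φ_long⁺)` of long positive
roots which contains the long simple roots (long = squared length `4` here; this is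
used for types `B`, `C`, `F₄`). -/
def C0 (l : ℕ) (A : Matrix (Fin l) (Fin l) ℤ) (d : Fin l → ℤ) : Set (RL l) :=
  {v | ∃ i : Fin l, sroot l i ∈ lenSet l A d 4 ∧ hconn l (posLen l A d 4) (sroot l i) v}

section Symmetrizable

variable {l : ℕ} {A : Matrix (Fin l) (Fin l) ℤ} {d : Fin l → ℤ}

/-- The symmetric bilinear form whose quadratic form is `nsq`. -/
def bform (l : ℕ) (A : Matrix (Fin l) (Fin l) ℤ) (d : Fin l → ℤ) (v w : RL l) : ℤ :=
  ∑ i, ∑ j, d i * A i j * v i * w j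

lemma bform_comm (hsym : ∀ i j, d i * A i j = d j * A j i) (v w : RL l) :
    bform l A d v w = bform l A d w v := by
  unfold bform
  rw [Finset.sum_comm]
  refine Finset.sum_congr rfl fun i _ => Finset.sum_congr rfl fun j _ => ?_
  rw [hsym j i]
  ring

lemma nsq_add (hsym : ∀ i j, d i * A i j = d j * A j i) (v w : RL l) :
    nsq l A d (v + w) = nsq l A d v + nsq l A d w + 2 * bform l A d v w := by
  have h : nsq l A d (v + w) =
      nsq l A d v + nsq l A d w + bform l A d v w + bform l A d w v := by
    simp only [nsq, bform, ← Finset.sum_add_distrib]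
    refine Finset.sum_congr rfl fun i _ => Finset.sum_congr rfl fun j _ => ?_
    simp only [Pi.add_apply]
    ring
  rw [h, bform_comm hsym w v]
  ring

lemma bform_eq_sum_cmPair (v w : RL l) :
    bform l A d w v = ∑ i, d i * w i * cmPair l A v i := by
  simp only [bform, cmPair, Finset.mul_sum]
  refine Finset.sum_congr rfl fun i _ => Finset.sum_congr rfl fun j _ => ?_
  ring

lemma bform_smul_sroot (hsym : ∀ i j, d i * A i j = d j * A j i) (v : RL l) (k : ℤ)
    (i : Fin l) : bform l A d v (k • sroot l i) = k * (d i * cmPair l A v i) := by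
  rw [bform_comm hsym, bform_eq_sum_cmPair, Finset.sum_eq_single i]
  · simp [sroot]
    ring
  · intro j _ hj
    simp [sroot, hj]
  · simp

lemma nsq_smul_sroot (hdiag : ∀ i, A i i = 2) (k : ℤ) (i : Fin l) :
    nsq l A d (k • sroot l i) = 2 * d i * k ^ 2 := by
  unfold nsq
  rw [Finset.sum_eq_single i, Finset.sum_eq_single i]
  · simp [sroot, hdiag]
    ring
  · intro j _ hj
    simp [sroot, hj]
  · simp
  · intro j _ hj
    simp [sroot, hj]
  · simp

lemma nsq_sroot (hdiag : ∀ i, A i i = 2) (i : Fin l) : nsq l A d (sroot l i) = 2 * d i := by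
  simpa using nsq_smul_sroot (d := d) hdiag 1 i

lemma nsq_sub_smul_sroot (hsym : ∀ i j, d i * A i j = d j * A j i) (hdiag : ∀ i, A i i = 2)
    (v : RL l) (k : ℤ) (i : Fin l) :
    nsq l A d (v - k • sroot l i) =
      nsq l A d v - 2 * d i * k * cmPair l A v i + 2 * d i * k ^ 2 := by
  rw [sub_eq_add_neg, ← neg_smul, nsq_add hsym, nsq_smul_sroot hdiag, bform_smul_sroot hsym]
  ring

lemma sroot_mem_rootsOf (i : Fin l) : sroot l i ∈ rootsOf l A :=
  Set.mem_sInter.mpr fun _ hT => hT.1 ⟨i, rfl⟩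

lemma reflection_mem_rootsOf {v : RL l} (hv : v ∈ rootsOf l A) (i : Fin l) :
    v - cmPair l A v i • sroot l i ∈ rootsOf l A :=
  Set.mem_sInter.mpr fun T hT => hT.2 v (Set.mem_sInter.mp hv T hT) i

lemma bform_even {v : RL l} (hv : ∀ i, Even (d i * v i)) (w : RL l) :
    Even (bform l A d v w) := by
  rw [bform_eq_sum_cmPair]
  exact Finset.even_sum _ fun i _ => (hv i).mul_right _

/-- In a long root, the coefficients of the short simple roots are even. -/
lemma even_of_long (hsym : ∀ i j, d i * A i j = d j * A j i) (hdiag : ∀ i, A i i = 2)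
    (hd : ∀ i, d i = 1 ∨ d i = 2) {v : RL l} (hv : v ∈ lenSet l A d 4) (i : Fin l) :
    Even (d i * v i) := by
  have key : nsq l A d v = 2 ∨ nsq l A d v = 4 ∧ ∀ i, Even (d i * v i) := by
    refine Set.mem_sInter.mp hv.1
      {v | nsq l A d v = 2 ∨ nsq l A d v = 4 ∧ ∀ i, Even (d i * v i)} ⟨?_, ?_⟩
    · rintro _ ⟨j, rfl⟩
      rcases hd j with h | h
      · exact Or.inl (by rw [nsq_sroot hdiag, h]; rfl)
      · refine Or.inr ⟨by rw [nsq_sroot hdiag, h]; rfl, fun i => ?_⟩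
        by_cases hij : i = j
        · subst hij
          simp [h]
        · simp [sroot, hij]
    · intro v hv j
      have hn : nsq l A d (v - cmPair l A v j • sroot l j) = nsq l A d v := by
        rw [nsq_sub_smul_sroot hsym hdiag]
        ring
      rw [Set.mem_ofPred_eq, hn]
      refine hv.imp_right fun ⟨h4, he⟩ => ⟨h4, fun i => ?_⟩
      by_cases hij : i = j
      · subst hij
        have hc : Even (d i * cmPair l A v i) := by
          have := bform_even (A := A) he (sroot l i)
          rwa [← one_smul ℤ (sroot l i), bform_smul_sroot hsym, one_mul] at this
        simpa [sroot, mul_sub] using (he i).sub hc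
      · simpa [sroot, hij] using he i
  rcases key with h | h
  · have := hv.2
    omega
  · exact h.2 i

lemma C0_subset_posLen {v : RL l} (hv : v ∈ C0 l A d) : v ∈ posLen l A d 4 := by
  obtain ⟨i, hi, hc⟩ := hv
  rcases Relation.ReflTransGen.cases_tail hc with h | ⟨_, _, h⟩
  · subst h
    have h0 : (0 : RL l) ≤ sroot l i := Pi.single_nonneg.2 zero_le_one
    exact ⟨hi, h0⟩
  · exact h.2.1

/-- Roots in `𝒞₀` are supported on the long simple roots. -/
lemma apply_eq_zero_of_mem_C0 (hsym : ∀ i j, d i * A i j = d j * A j i)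
    (hdiag : ∀ i, A i i = 2) (hd : ∀ i, d i = 1 ∨ d i = 2) {v : RL l} (hv : v ∈ C0 l A d) :
    ∀ j, d j = 1 → v j = 0 := by
  obtain ⟨i, hi, hc⟩ := hv
  induction hc with
  | refl =>
    intro j hj
    have h := hi.2
    rw [nsq_sroot hdiag] at h
    have hij : j ≠ i := by
      rintro rfl
      omega
    simp [sroot, hij]
  | @tail u w _ hstep ih =>
    intro j hj
    obtain ⟨_, hw, k, hk⟩ := hstep
    have he := even_of_long hsym hdiag hd hw.1 j
    have hu := ih j hj
    rw [hj, one_mul] at he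
    have hs : sroot l k j = 0 ∨ sroot l k j = 1 := by
      by_cases hjk : j = k
      · subst hjk
        simp [sroot]
      · simp [sroot, hjk]
    obtain ⟨m, hm⟩ := he
    rcases hk with rfl | rfl <;> simp only [Pi.add_apply] at hu hm ⊢ <;> omega

/-- If the form is positive definite on the span of the long simple roots, then every long
positive root in this span belongs to `𝒞₀`. -/
lemma mem_C0_of_apply_eq_zero (hsym : ∀ i j, d i * A i j = d j * A j i)
    (hdiag : ∀ i, A i i = 2) (hd : ∀ i, d i = 1 ∨ d i = 2)
    (hpos : ∀ w : RL l, (∀ i, d i = 1 → w i = 0) →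
      0 ≤ nsq l A d w ∧ (nsq l A d w = 0 → w = 0))
    {v : RL l} (hv : v ∈ posLen l A d 4) (hsupp : ∀ i, d i = 1 → v i = 0) :
    v ∈ C0 l A d := by
  induction hn : (∑ i, v i).toNat using Nat.strong_induction_on generalizing v with
  | _ n ih =>
  obtain ⟨⟨hroot, h4⟩, hnn⟩ := hv
  have hsum : 0 < ∑ i, d i * v i * cmPair l A v i := by
    rw [← bform_eq_sum_cmPair]
    change 0 < nsq l A d v
    omega
  obtain ⟨i, _, hi⟩ := Finset.exists_lt_of_sum_lt (s := Finset.univ) (f := fun _ => (0 : ℤ))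
    (by simpa using hsum)
  have hvi : v i ≠ 0 := fun h => by simp [h] at hi
  have hdi : d i = 2 := (hd i).resolve_left fun h => hvi (hsupp i h)
  have hvi1 : 1 ≤ v i := by
    have := hnn i
    omega
  have hc : 0 < cmPair l A v i := by
    rw [hdi] at hi
    exact pos_of_mul_pos_right hi (by omega)
  have hw0 : ∀ j, d j = 1 → (v - (1 : ℤ) • sroot l i) j = 0 := by
    intro j hj
    have hij : j ≠ i := by
      rintro rfl
      omega
    simp [sroot, hij, hsupp j hj]
  have hnsq := nsq_sub_smul_sroot hsym hdiag v 1 i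
  obtain ⟨hge, hzero⟩ := hpos _ hw0
  rw [hdi, h4] at hnsq
  have hc12 : cmPair l A v i = 1 ∨ cmPair l A v i = 2 := by omega
  rw [one_smul] at *
  rcases hc12 with h1 | h2
  · have hwroot := reflection_mem_rootsOf hroot i
    rw [h1, one_smul] at hwroot
    have hwpos : v - sroot l i ∈ posLen l A d 4 := by
      refine ⟨⟨hwroot, by omega⟩, fun j => ?_⟩
      by_cases hij : j = i
      · subst hij
        simpa [sroot] using hvi1
      · simpa [sroot, hij] using hnn j
    have hs : ∑ j, (v - sroot l i) j = ∑ j, v j - 1 := by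
      simp [sroot, Finset.sum_sub_distrib]
    have hle : v i ≤ ∑ j, v j :=
      Finset.single_le_sum (fun j _ => hnn j) (Finset.mem_univ i)
    obtain ⟨k, hk, hkc⟩ := ih _ (by omega) hwpos hw0 rfl
    exact ⟨k, hk, hkc.tail ⟨hwpos, ⟨⟨hroot, h4⟩, hnn⟩, i, Or.inl (by simp)⟩⟩
  · have hvs : v = sroot l i := sub_eq_zero.mp (hzero (by omega))
    subst hvs
    exact ⟨i, ⟨hroot, h4⟩, Relation.ReflTransGen.refl⟩

lemma not_long_add_short (hsym : ∀ i j, d i * A i j = d j * A j i) (hdiag : ∀ i, A i i = 2)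
    (hd : ∀ i, d i = 1 ∨ d i = 2) {β γ : RL l} (hβ : β ∈ lenSet l A d 4)
    (hγ : γ ∈ lenSet l A d 2) : β + γ ∉ lenSet l A d 4 := by
  intro h
  have h1 := nsq_add hsym β γ
  obtain ⟨m, hm⟩ := bform_even (A := A) (even_of_long hsym hdiag hd hβ) γ
  rw [h.2, hβ.2, hγ.2] at h1
  omega

theorem short_summands_of_not_mem_C0 (hsym : ∀ i j, d i * A i j = d j * A j i)
    (hdiag : ∀ i, A i i = 2) (hd : ∀ i, d i = 1 ∨ d i = 2)
    (hpos : ∀ w : RL l, (∀ i, d i = 1 → w i = 0) →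
      0 ≤ nsq l A d w ∧ (nsq l A d w = 0 → w = 0))
    (α : RL l) (hα : α ∈ lenSet l A d 4) (β : RL l) (hβ : β ∈ posRoots l A)
    (γ : RL l) (hγ : γ ∈ posRoots l A) (hsum : α = β + γ) (hα0 : α ∉ C0 l A d)
    (hβ' : β ∈ C0 l A d ∨ β ∈ posLen l A d 2) (hγ' : γ ∈ C0 l A d ∨ γ ∈ posLen l A d 2) :
    β ∈ lenSet l A d 2 ∧ γ ∈ lenSet l A d 2 := by
  subst hsum
  rcases hβ' with hb | hb <;> rcases hγ' with hc | hc
  · refine absurd (mem_C0_of_apply_eq_zero hsym hdiag hd hpos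
      ⟨hα, fun i => add_nonneg (hβ.2 i) (hγ.2 i)⟩ fun i hi => ?_) hα0
    simp [apply_eq_zero_of_mem_C0 hsym hdiag hd hb i hi,
      apply_eq_zero_of_mem_C0 hsym hdiag hd hc i hi]
  · exact absurd hα (not_long_add_short hsym hdiag hd (C0_subset_posLen hb).1 hc.1)
  · rw [add_comm] at hα
    exact absurd hα (not_long_add_short hsym hdiag hd (C0_subset_posLen hc).1 hb.1)
  · exact ⟨hb.1, hc.1⟩

end Symmetrizable

lemma nsq_B_succ_succ (n : ℕ) (v : RL (n + 2)) :
    nsq (n + 2) (CM_B (n + 2)) (dB (n + 2)) v =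
      4 * v 0 ^ 2 - 4 * v 0 * v 1 +
        nsq (n + 1) (CM_B (n + 1)) (dB (n + 1)) fun i => v i.succ := by
  have hsub : ∀ i j : Fin (n + 1), dB (n + 2) i.succ * CM_B (n + 2) i.succ j.succ =
      dB (n + 1) i * CM_B (n + 1) i j := by
    intro i j
    simp only [dB, CM_B, Matrix.of_apply, Fin.val_succ, Fin.succ_inj, Nat.add_sub_cancel]
    have h1 : (i : ℕ) + 1 = n + 2 - 1 ↔ (i : ℕ) = n := by omega
    simp only [h1, Nat.add_right_cancel_iff]
  have h00 : dB (n + 2) 0 * CM_B (n + 2) 0 0 = 4 := by simp [dB, CM_B]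
  have h0s : ∀ j : Fin (n + 1), dB (n + 2) 0 * CM_B (n + 2) 0 j.succ =
      if j = 0 then -2 else 0 := by
    intro j
    by_cases hj : j = 0 <;> simp [dB, CM_B, hj, Fin.ext_iff]
  have hs0 : ∀ i : Fin (n + 1), dB (n + 2) i.succ * CM_B (n + 2) i.succ 0 =
      if i = 0 then -2 else 0 := by
    intro j
    by_cases hj : j = 0
    · subst hj
      by_cases hn : n = 0 <;> simp [dB, CM_B, hn]
    · simp [dB, CM_B, hj]
  unfold nsq
  rw [Fin.sum_univ_succ, Fin.sum_univ_succ]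
  simp only [Fin.sum_univ_succ (n := n + 1), h00, h0s, hs0, hsub, Finset.sum_add_distrib,
    ite_mul, zero_mul, Finset.sum_ite_eq', Finset.mem_univ, if_true]
  simp only [Fin.succ_zero_eq_one]
  ring

lemma nsq_B_ge (n : ℕ) (v : RL (n + 1)) :
    2 * v 0 ^ 2 ≤ nsq (n + 1) (CM_B (n + 1)) (dB (n + 1)) v := by
  induction n with
  | zero =>
    simp [nsq, dB, CM_B]
    nlinarith
  | succ n ih =>
    have h := ih fun i => v i.succ
    rw [nsq_B_succ_succ]
    simp only [Fin.succ_zero_eq_one] at h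
    nlinarith [sq_nonneg (v 0 - v 1)]

lemma eq_zero_of_nsq_B (n : ℕ) (v : RL (n + 1))
    (hv : nsq (n + 1) (CM_B (n + 1)) (dB (n + 1)) v = 0) : v = 0 := by
  have h0 : v 0 = 0 := by
    have := nsq_B_ge n v
    nlinarith [sq_nonneg (v 0)]
  induction n with
  | zero =>
    ext i
    rw [show i = 0 by omega, h0]
    rfl
  | succ n ih =>
    rw [nsq_B_succ_succ, h0] at hv
    have ht : nsq (n + 1) (CM_B (n + 1)) (dB (n + 1)) (fun i => v i.succ) = 0 := by
      linarith
    have ht0 : v (Fin.succ 0) = 0 := by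
      have := nsq_B_ge n fun i => v i.succ
      nlinarith [sq_nonneg (v (Fin.succ 0))]
    have h := ih _ ht ht0
    ext i
    refine Fin.cases h0 (fun j => congrFun h j) i

lemma eq_smul_sroot_of_supp_C {l : ℕ} (hl : 2 ≤ l) {w : RL l} (hw : ∀ i, dC l i = 1 → w i = 0) :
    ∃ k : ℤ, w = k • sroot l ⟨l - 1, by omega⟩ := by
  refine ⟨w ⟨l - 1, by omega⟩, funext fun i => ?_⟩
  by_cases hi : i = ⟨l - 1, by omega⟩
  · subst hi
    simp [sroot]
  · rw [hw i]
    · simp [sroot, hi]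
    · simpa [dC, Fin.ext_iff] using hi

/-- In types `B_l (l ≥ 2)`, `C_l (l ≥ 2)` and `F₄`: if a long root `α`
satisfies `α = β + γ` with `β, γ ∈ Φ⁺`, `α ∉ 𝒞₀`, and both `β` and `γ` lie in
`𝒞₀ ∪ H(Φ_short⁺)`, then both `β` and `γ` are short. -/
theorem summands_outside_C0_are_short :
    (∀ l : ℕ, 2 ≤ l → ∀ α ∈ lenSet l (CM_B l) (dB l) 4,
      ∀ β ∈ posRoots l (CM_B l), ∀ γ ∈ posRoots l (CM_B l), α = β + γ →
      α ∉ C0 l (CM_B l) (dB l) →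
      (β ∈ C0 l (CM_B l) (dB l) ∨ β ∈ posLen l (CM_B l) (dB l) 2) →
      (γ ∈ C0 l (CM_B l) (dB l) ∨ γ ∈ posLen l (CM_B l) (dB l) 2) →
      β ∈ lenSet l (CM_B l) (dB l) 2 ∧ γ ∈ lenSet l (CM_B l) (dB l) 2) ∧
    (∀ l : ℕ, 2 ≤ l → ∀ α ∈ lenSet l (CM_C l) (dC l) 4,
      ∀ β ∈ posRoots l (CM_C l), ∀ γ ∈ posRoots l (CM_C l), α = β + γ →
      α ∉ C0 l (CM_C l) (dC l) →
      (β ∈ C0 l (CM_C l) (dC l) ∨ β ∈ posLen l (CM_C l) (dC l) 2) →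
      (γ ∈ C0 l (CM_C l) (dC l) ∨ γ ∈ posLen l (CM_C l) (dC l) 2) →
      β ∈ lenSet l (CM_C l) (dC l) 2 ∧ γ ∈ lenSet l (CM_C l) (dC l) 2) ∧
    (∀ α ∈ lenSet 4 (CM_F4 4) (dF4 4) 4,
      ∀ β ∈ posRoots 4 (CM_F4 4), ∀ γ ∈ posRoots 4 (CM_F4 4), α = β + γ →
      α ∉ C0 4 (CM_F4 4) (dF4 4) →
      (β ∈ C0 4 (CM_F4 4) (dF4 4) ∨ β ∈ posLen 4 (CM_F4 4) (dF4 4) 2) →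
      (γ ∈ C0 4 (CM_F4 4) (dF4 4) ∨ γ ∈ posLen 4 (CM_F4 4) (dF4 4) 2) →
      β ∈ lenSet 4 (CM_F4 4) (dF4 4) 2 ∧ γ ∈ lenSet 4 (CM_F4 4) (dF4 4) 2) := by
  refine ⟨fun l hl => ?_, fun l hl => ?_, ?_⟩
  · refine short_summands_of_not_mem_C0 ?_ ?_ ?_ ?_
    · intro i j
      have := i.isLt
      have := j.isLt
      simp only [CM_B, dB, Matrix.of_apply, Fin.ext_iff]
      split_ifs <;> omega
    · simp [CM_B]
    · intro i
      unfold dB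
      split_ifs <;> simp
    · intro w _
      obtain ⟨n, rfl⟩ : ∃ n, l = n + 1 := ⟨l - 1, by omega⟩
      exact ⟨(by positivity : (0 : ℤ) ≤ 2 * w 0 ^ 2).trans (nsq_B_ge n w),
        eq_zero_of_nsq_B n w⟩
  · have hdiag : ∀ i, CM_C l i i = 2 := by simp [CM_C]
    refine short_summands_of_not_mem_C0 ?_ hdiag ?_ ?_
    · intro i j
      have := i.isLt
      have := j.isLt
      simp only [CM_C, dC, Matrix.of_apply, Fin.ext_iff]
      split_ifs <;> omega
    · intro i
      unfold dC
      split_ifs <;> simp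
    · intro w hw
      obtain ⟨k, rfl⟩ := eq_smul_sroot_of_supp_C hl hw
      rw [nsq_smul_sroot hdiag]
      simp only [dC, if_true]
      refine ⟨by positivity, fun h => ?_⟩
      have hk : k = 0 := by simpa using h
      rw [hk, zero_smul]
  · refine short_summands_of_not_mem_C0 (by decide) (by decide) (by decide) ?_
    intro w hw
    have h2 : w 2 = 0 := hw 2 (by decide)
    have h3 : w 3 = 0 := hw 3 (by decide)
    have hn : nsq 4 (CM_F4 4) (dF4 4) w = 4 * w 0 ^ 2 - 4 * w 0 * w 1 + 4 * w 1 ^ 2 := by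
      simp [nsq, CM_F4, dF4, Fin.sum_univ_four, h2, h3]
      ring
    rw [hn]
    refine ⟨by nlinarith [sq_nonneg (w 0 - w 1), sq_nonneg (w 0), sq_nonneg (w 1)], fun h => ?_⟩
    have h0 : w 0 = 0 := by
      nlinarith [sq_nonneg (w 0 - w 1), sq_nonneg (w 0), sq_nonneg (w 1)]
    have h1 : w 1 = 0 := by
      nlinarith [sq_nonneg (w 0 - w 1), sq_nonneg (w 0), sq_nonneg (w 1)]
    ext i
    fin_cases i <;> assumption

end Paper

end
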